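/- (Yang multiplication, first form.) If normal sequences NS(l) exist and base sequences BS(r,s) exist, then T-sequences of length (2l+1)(r+s) exist. -/

import Mathlib

open Finset Matrix Kronecker

/-- Nonperiodic autocorrelation `N_X(j)` of a sequence of length `m` (0-indexed):
`N_X(j) = ∑_{k=0}^{m-j-1} x_k x_{k+j}`. -/
def autocorr (m : ℕ) (X : ℕ → ℤ) (j : ℕ) : ℤ :=
  ∑ k ∈ Finset.range (m - j), X k * X (k + j)

/-- A binary (±1) sequence of length `m`. -/
def IsBinarySeq (m : ℕ) (X : ℕ → ℤ) : Prop :=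
  ∀ i < m, X i = 1 ∨ X i = -1

/-- Base sequences `BS(r,s)`: binary sequences `A, B` of length `r` and `C, D` of
length `s` whose nonperiodic autocorrelations sum to zero for all `j ≥ 1`. -/
def IsBaseSeq (r s : ℕ) (A B C D : ℕ → ℤ) : Prop :=
  IsBinarySeq r A ∧ IsBinarySeq r B ∧ IsBinarySeq s C ∧ IsBinarySeq s D ∧
    ∀ j, 1 ≤ j →
      autocorr r A j + autocorr r B j + autocorr s C j + autocorr s D j = 0

/-- A Golay pair of length `g`. -/
def IsGolayPair (g : ℕ) (A B : ℕ → ℤ) : Prop :=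
  IsBinarySeq g A ∧ IsBinarySeq g B ∧
    ∀ j, 1 ≤ j → autocorr g A j + autocorr g B j = 0

/-- Normal sequences `NS(n)`: base sequences in `BS(n+1,n)` whose first two
sequences agree in the first `n` entries. -/
def IsNormalSeq (n : ℕ) (A B C D : ℕ → ℤ) : Prop :=
  IsBaseSeq (n + 1) n A B C D ∧ ∀ i < n, B i = A i

/-- Near-normal sequences `NN(n)`: base sequences in `BS(n+1,n)` with
`b_i = (-1)^(i-1) a_i` for `i = 1, …, n` (0-indexed: `B i = (-1)^i * A i`). -/
def IsNearNormalSeq (n : ℕ) (A B C D : ℕ → ℤ) : Prop :=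
  IsBaseSeq (n + 1) n A B C D ∧ ∀ i < n, B i = (-1) ^ i * A i

/-- T-sequences of length `t`: four `{-1,0,1}`-sequences such that at every
position exactly one of them is nonzero, and the sum of their nonperiodic
autocorrelations vanishes for all `j ≥ 1`. -/
def IsTSeq (t : ℕ) (T₁ T₂ T₃ T₄ : ℕ → ℤ) : Prop :=
  (∀ i < t, T₁ i ∈ ({-1, 0, 1} : Set ℤ)) ∧
  (∀ i < t, T₂ i ∈ ({-1, 0, 1} : Set ℤ)) ∧
  (∀ i < t, T₃ i ∈ ({-1, 0, 1} : Set ℤ)) ∧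
  (∀ i < t, T₄ i ∈ ({-1, 0, 1} : Set ℤ)) ∧
  (∀ i < t,
    (T₁ i ≠ 0 ∧ T₂ i = 0 ∧ T₃ i = 0 ∧ T₄ i = 0) ∨
    (T₁ i = 0 ∧ T₂ i ≠ 0 ∧ T₃ i = 0 ∧ T₄ i = 0) ∨
    (T₁ i = 0 ∧ T₂ i = 0 ∧ T₃ i ≠ 0 ∧ T₄ i = 0) ∨
    (T₁ i = 0 ∧ T₂ i = 0 ∧ T₃ i = 0 ∧ T₄ i ≠ 0)) ∧
  ∀ j, 1 ≤ j →
    autocorr t T₁ j + autocorr t T₂ j + autocorr t T₃ j + autocorr t T₄ j = 0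

/-- An orthogonal design `OD(4d; d,d,d,d)`: four `4d × 4d` matrices with entries
in `{-1,0,1}`, pairwise disjoint supports covering every position, with
`Aᵢ Aᵢᵀ = d·I` and `Aᵢ Aⱼᵀ + Aⱼ Aᵢᵀ = 0` for `i ≠ j`. -/
def IsOD (d : ℕ) (A : Fin 4 → Matrix (Fin (4 * d)) (Fin (4 * d)) ℤ) : Prop :=
  (∀ k i j, A k i j ∈ ({-1, 0, 1} : Set ℤ)) ∧
  (∀ i j, ∃! k : Fin 4, A k i j ≠ 0) ∧
  (∀ k, A k * (A k)ᵀ = (d : ℤ) • 1) ∧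
  (∀ k l, k ≠ l → A k * (A l)ᵀ + A l * (A k)ᵀ = 0)

/-- Williamson-type matrices of order `w`: four pairwise amicable `±1` matrices
with `∑ Wᵢ Wᵢᵀ = 4w·I`. -/
def IsWilliamsonType (w : ℕ) (W : Fin 4 → Matrix (Fin w) (Fin w) ℤ) : Prop :=
  (∀ k i j, W k i j = 1 ∨ W k i j = -1) ∧
  (∀ k l, W k * (W l)ᵀ = W l * (W k)ᵀ) ∧
  (∑ k, W k * (W k)ᵀ) = ((4 * w : ℕ) : ℤ) • 1

/-- A Hadamard matrix: a `±1` matrix `H` with `H Hᵀ = m·I`, where `m` is the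
size of the (finite) index type. -/
def IsHadamardMatrix {n : Type*} [Fintype n] [DecidableEq n] (H : Matrix n n ℤ) : Prop :=
  (∀ i j, H i j = 1 ∨ H i j = -1) ∧ H * Hᵀ = (Fintype.card n : ℤ) • 1

section Generating

variable {R : Type*} [CommRing R]

/-- The value at `u` of the generating polynomial of the first `m` terms of `X`. -/
def genSum (u : R) (m : ℕ) (X : ℕ → ℤ) : R :=
  ∑ i ∈ range m, (X i : R) * u ^ i

lemma autocorr_eq_zero_of_le {m j : ℕ} (X : ℕ → ℤ) (h : m ≤ j) : autocorr m X j = 0 := by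
  simp [autocorr, Nat.sub_eq_zero_of_le h]

lemma autocorr_succ (m : ℕ) (X : ℕ → ℤ) (j : ℕ) :
    autocorr (m + 1) X j = autocorr m X j + if j ≤ m then X (m - j) * X m else 0 := by
  split_ifs with h
  · rw [autocorr, autocorr, Nat.succ_sub h, sum_range_succ, Nat.sub_add_cancel h]
  · rw [autocorr_eq_zero_of_le X (by omega), autocorr_eq_zero_of_le X (by omega), add_zero]

lemma pow_mul_pow_of_mul_eq_one {u v : R} (huv : u * v = 1) {m i : ℕ} (h : i ≤ m) :
    u ^ m * v ^ i = u ^ (m - i) := by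
  obtain ⟨d, rfl⟩ := Nat.exists_eq_add_of_le h
  rw [Nat.add_sub_cancel_left, pow_add, mul_right_comm, ← mul_pow, huv, one_pow, one_mul]

/-- The squared modulus of a generating polynomial is the generating function of the
autocorrelations. -/
lemma genSum_mul_genSum {u v : R} (huv : u * v = 1) (X : ℕ → ℤ) {m M : ℕ} (hM : m ≤ M) :
    genSum u m X * genSum v m X = (autocorr m X 0 : R) +
      ∑ j ∈ range M, (autocorr m X (j + 1) : R) * (u ^ (j + 1) + v ^ (j + 1)) := by
  induction m with
  | zero => simp [genSum, autocorr]
  | succ m ih =>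
    have hvu : v * u = 1 := by rw [mul_comm, huv]
    have hone : u ^ m * v ^ m = 1 := by rw [← mul_pow, huv, one_pow]
    have hsum : ∑ j ∈ range M, ((if j + 1 ≤ m then X (m - (j + 1)) * X m else 0 : ℤ) : R) *
        (u ^ (j + 1) + v ^ (j + 1)) =
        X m * u ^ m * genSum v m X + X m * v ^ m * genSum u m X := by
      obtain ⟨d, rfl⟩ := Nat.exists_eq_add_of_le (Nat.le_of_succ_le hM)
      rw [sum_range_add, genSum, genSum, mul_sum, mul_sum, ← sum_add_distrib,
        sum_eq_zero (s := range d), add_zero, ← sum_range_reflect]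
      · refine sum_congr rfl fun j hj => ?_
        have hj := mem_range.1 hj
        rw [if_pos (by omega), show m - 1 - j + 1 = m - j by omega,
          show m - (m - j) = j by omega, ← pow_mul_pow_of_mul_eq_one huv hj.le,
          ← pow_mul_pow_of_mul_eq_one hvu hj.le]
        push_cast
        ring
      · intro j _
        rw [if_neg (by omega)]
        simp
    have hsucc (w : R) : genSum w (m + 1) X = genSum w m X + X m * w ^ m := sum_range_succ _ _
    simp only [hsucc, autocorr_succ, Int.cast_add, add_mul, sum_add_distrib, hsum]
    simp only [Nat.zero_le, if_true, Nat.sub_zero, Int.cast_mul]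
    linear_combination ih (by omega) + (X m : R) ^ 2 * hone

lemma genSum_reflect {u v : R} (huv : u * v = 1) (m : ℕ) (X : ℕ → ℤ) :
    genSum u m (fun i => X (m - 1 - i)) = u ^ m * v * genSum v m X := by
  rw [genSum, genSum, ← sum_range_reflect, mul_sum]
  refine sum_congr rfl fun i hi => ?_
  have hi := mem_range.1 hi
  rw [show m - 1 - (m - 1 - i) = i by omega, show m - 1 - i = m - (i + 1) by omega,
    ← pow_mul_pow_of_mul_eq_one huv (show i + 1 ≤ m by omega)]
  ring

lemma genSum_add (u : R) (m : ℕ) (X Y : ℕ → ℤ) :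
    genSum u m (fun i => X i + Y i) = genSum u m X + genSum u m Y := by
  simp [genSum, add_mul, sum_add_distrib]

lemma genSum_neg (u : R) (m : ℕ) (X : ℕ → ℤ) :
    genSum u m (fun i => -X i) = -genSum u m X := by
  simp [genSum]

lemma genSum_sub (u : R) (m : ℕ) (X Y : ℕ → ℤ) :
    genSum u m (fun i => X i - Y i) = genSum u m X - genSum u m Y := by
  simp [genSum, sub_mul]

lemma genSum_const_mul (u : R) (m : ℕ) (c : ℤ) (X : ℕ → ℤ) :
    genSum u m (fun i => c * X i) = c * genSum u m X := by
  simp [genSum, mul_sum, mul_assoc]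

lemma genSum_zero (u : R) (m : ℕ) : genSum u m (fun _ => 0) = 0 := by
  simp [genSum]

/-- The first `r` terms of `X` followed by `Z`. -/
def appendSeq (r : ℕ) (X Z : ℕ → ℤ) (p : ℕ) : ℤ :=
  if p < r then X p else Z (p - r)

lemma genSum_appendSeq (u : R) (r s : ℕ) (X Z : ℕ → ℤ) :
    genSum u (r + s) (appendSeq r X Z) = genSum u r X + u ^ r * genSum u s Z := by
  rw [genSum, sum_range_add, genSum, genSum, mul_sum]
  congr 1
  · refine sum_congr rfl fun i hi => ?_
    rw [appendSeq, if_pos (mem_range.1 hi)]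
  · refine sum_congr rfl fun i _ => ?_
    rw [appendSeq, if_neg (by omega), Nat.add_sub_cancel_left]
    ring

/-- The concatenation of the blocks `E 0, O 0, E 1, O 1, …, E (l - 1), O (l - 1), L`, each of
length `t`. -/
def tileSeq (t l : ℕ) (E O : ℕ → ℕ → ℤ) (L : ℕ → ℤ) (n : ℕ) : ℤ :=
  if n / t = 2 * l then L (n % t)
  else if n / t % 2 = 0 then E (n / t / 2) (n % t) else O (n / t / 2) (n % t)

lemma genSum_mul_length (u : R) (t m : ℕ) (X : ℕ → ℤ) :
    genSum u (m * t) X = ∑ b ∈ range m, (u ^ t) ^ b * genSum u t (fun p => X (b * t + p)) := by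
  induction m with
  | zero => simp [genSum]
  | succ m ih =>
    rw [sum_range_succ, ← ih, Nat.succ_mul, genSum, sum_range_add, genSum, genSum, mul_sum]
    congr 1
    refine sum_congr rfl fun i _ => ?_
    rw [← pow_mul]
    ring

lemma sum_range_two_mul (m : ℕ) (φ : ℕ → R) :
    ∑ b ∈ range (2 * m), φ b = ∑ k ∈ range m, (φ (2 * k) + φ (2 * k + 1)) := by
  induction m with
  | zero => simp
  | succ m ih =>
    rw [Nat.mul_succ, sum_range_succ, sum_range_succ, ih, sum_range_succ, add_assoc]

lemma genSum_congr (u : R) {m : ℕ} {X Y : ℕ → ℤ} (h : ∀ i < m, X i = Y i) :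
    genSum u m X = genSum u m Y :=
  sum_congr rfl fun i hi => by rw [h i (mem_range.1 hi)]

lemma genSum_tileSeq (u : R) (t l : ℕ) (E O : ℕ → ℕ → ℤ) (L : ℕ → ℤ) :
    genSum u ((2 * l + 1) * t) (tileSeq t l E O L) =
      ∑ k ∈ range l, (u ^ (2 * t)) ^ k * genSum u t (E k) +
      u ^ t * ∑ k ∈ range l, (u ^ (2 * t)) ^ k * genSum u t (O k) +
      (u ^ (2 * t)) ^ l * genSum u t L := by
  have hdiv {b p : ℕ} (hp : p < t) : (b * t + p) / t = b := by
    rw [mul_comm, Nat.mul_add_div (by omega), Nat.div_eq_of_lt hp, add_zero]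
  have hmod {b p : ℕ} (hp : p < t) : (b * t + p) % t = p := by
    rw [mul_comm, Nat.mul_add_mod, Nat.mod_eq_of_lt hp]
  have hpow (k : ℕ) : (u ^ (2 * t)) ^ k = (u ^ t) ^ (2 * k) := by
    rw [← pow_mul, ← pow_mul]
    ring_nf
  rw [genSum_mul_length, sum_range_succ, sum_range_two_mul, mul_sum, ← sum_add_distrib]
  congr 1
  · refine sum_congr rfl fun k hk => ?_
    have hk := mem_range.1 hk
    congr 1
    · rw [hpow]
      congr 1
      refine genSum_congr u fun p hp => ?_
      rw [tileSeq, hdiv hp, hmod hp, if_neg (by omega), if_pos (by omega),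
        show 2 * k / 2 = k by omega]
    · rw [hpow, ← mul_assoc, ← pow_succ']
      congr 1
      refine genSum_congr u fun p hp => ?_
      rw [tileSeq, hdiv hp, hmod hp, if_neg (by omega), if_neg (by omega),
        show (2 * k + 1) / 2 = k by omega]
  · rw [hpow]
    congr 1
    refine genSum_congr u fun p hp => ?_
    rw [tileSeq, hdiv hp, hmod hp, if_pos rfl]

/-- Yang's form of the Lagrange four-square identity. -/
lemma yang_lagrange_identity (a a' b b' c c' d d' e e' f f' g g' h h' : R) :
    (a * f' + c * g - b' * e + d * h) * (a' * f + c' * g' - b * e' + d' * h') +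
    (b * f' + d * g' + a' * e - c * h') * (b' * f + d' * g + a * e' - c' * h) +
    (a * g' - c * f - b * h - d' * e) * (a' * g - c' * f' - b' * h' - d * e') +
    (b * g - d * f + a * h' + c' * e) * (b' * g' - d' * f' + a' * h + c * e') =
    (a * a' + b * b' + c * c' + d * d') * (e * e' + f * f' + g * g' + h * h') := by
  ring

/-- Yang's identity with the monomial shifts that appear when the four products are laid out in
blocks. -/
lemma yang_shifted_identity (a a' b b' c c' d d' f f' g g' h h' : R) {e e' k k' p p' y y' : R}
    (he : e * e' = 1) (hk : k * k' = 1) (hp : p * p' = 1) (hy : y * y' = 1) :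
    (k ^ 2 * f' * a + p * (g * c + h * d) - k * e * b') *
      (k' ^ 2 * f * a' + p' * (g' * c' + h' * d') - k' * e' * b) +
    (k ^ 2 * f' * b + p * (k ^ 2 * g' * d - k ^ 2 * h' * c) + k * e * a') *
      (k' ^ 2 * f * b' + p' * (k' ^ 2 * g * d' - k' ^ 2 * h * c') + k' * e' * a) +
    (y * (k ^ 2 * g' * a - h * b - p * (f * c)) - k * e * y * p' * d') *
      (y' * (k' ^ 2 * g * a' - h' * b' - p' * (f' * c')) - k' * e' * y' * p * d) +
    (y * (g * b + k ^ 2 * h' * a - p * (f * d)) + k * e * y * p' * c') *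
      (y' * (g' * b' + k' ^ 2 * h * a' - p' * (f' * d')) + k' * e' * y' * p * c) =
    (a * a' + b * b' + c * c' + d * d') * (1 + (f * f' + g * g' + h * h')) := by
  have hid := yang_lagrange_identity a a' b b' (p * c) (p' * c') (p * d) (p' * d') e e'
    (k' * f) (k * f') (k' * g) (k * g') (k' * h) (k * h')
  have hrhs : (a * a' + b * b' + p * c * (p' * c') + p * d * (p' * d')) *
      (e * e' + k' * f * (k * f') + k' * g * (k * g') + k' * h * (k * h')) =
      (a * a' + b * b' + c * c' + d * d') * (1 + (f * f' + g * g' + h * h')) := by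
    have h₁ (x x' : R) : p * x * (p' * x') = x * x' := by linear_combination x * x' * hp
    have h₂ (x x' : R) : k' * x * (k * x') = x * x' := by linear_combination x * x' * hk
    rw [h₁, h₁, h₂, h₂, h₂, he]
    ring
  have hmul (x x' : R) : k * x * (k' * x') = x * x' := by linear_combination x * x' * hk
  have hmul' (x x' : R) : y * (k * x) * (y' * (k' * x')) = x * x' := by
    linear_combination x * x' * (k * k' * hy + hk)
  have hq : k ^ 2 * f' * a + p * (g * c + h * d) - k * e * b' =
      k * (a * (k * f') + p * c * (k' * g) - b' * e + p * d * (k' * h)) := by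
    linear_combination -p * (g * c + h * d) * hk
  have hq' : k' ^ 2 * f * a' + p' * (g' * c' + h' * d') - k' * e' * b =
      k' * (a' * (k' * f) + p' * c' * (k * g') - b * e' + p' * d' * (k * h')) := by
    linear_combination -p' * (g' * c' + h' * d') * hk
  have hr : k ^ 2 * f' * b + p * (k ^ 2 * g' * d - k ^ 2 * h' * c) + k * e * a' =
      k * (b * (k * f') + p * d * (k * g') + a' * e - p * c * (k * h')) := by
    ring
  have hr' : k' ^ 2 * f * b' + p' * (k' ^ 2 * g * d' - k' ^ 2 * h * c') + k' * e' * a =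
      k' * (b' * (k' * f) + p' * d' * (k' * g) + a * e' - p' * c' * (k' * h)) := by
    ring
  have hs : y * (k ^ 2 * g' * a - h * b - p * (f * c)) - k * e * y * p' * d' =
      y * (k * (a * (k * g') - p * c * (k' * f) - b * (k' * h) - p' * d' * e)) := by
    linear_combination y * (h * b + p * (f * c)) * hk
  have hs' : y' * (k' ^ 2 * g * a' - h' * b' - p' * (f' * c')) - k' * e' * y' * p * d =
      y' * (k' * (a' * (k' * g) - p' * c' * (k * f') - b' * (k * h') - p * d * e')) := by
    linear_combination y' * (h' * b' + p' * (f' * c')) * hk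
  have ht : y * (g * b + k ^ 2 * h' * a - p * (f * d)) + k * e * y * p' * c' =
      y * (k * (b * (k' * g) - p * d * (k' * f) + a * (k * h') + p' * c' * e)) := by
    linear_combination y * (p * (f * d) - g * b) * hk
  have ht' : y' * (g' * b' + k' ^ 2 * h * a' - p' * (f' * d')) + k' * e' * y' * p * c =
      y' * (k' * (b' * (k * g') - p' * d' * (k * f') + a' * (k' * h) + p * c * e')) := by
    linear_combination y' * (p' * (f' * d') - g' * b') * hk
  rw [hq, hq', hr, hr', hs, hs', ht, ht', hmul, hmul, hmul', hmul', ← hrhs, ← hid]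

lemma sum_pow_mul_mul (w p c : R) (l : ℕ) (X : ℕ → ℤ) :
    ∑ k ∈ range l, w ^ k * (p * ((X k : R) * c)) = p * (genSum w l X * c) := by
  rw [genSum, sum_mul, mul_sum]
  exact sum_congr rfl fun k _ => by ring

lemma sum_pow_mul (w c : R) (l : ℕ) (X : ℕ → ℤ) :
    ∑ k ∈ range l, w ^ k * ((X k : R) * c) = genSum w l X * c := by
  simpa using sum_pow_mul_mul w 1 c l X

/-- The first of the four sequences in Yang's product. -/
def yangSeq₁ (l r s : ℕ) (F G H x y z w : ℕ → ℤ) : ℕ → ℤ :=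
  tileSeq (r + s) l
    (fun k => appendSeq r (fun i => F (l - 1 - k) * x i) (fun i => G k * z i + H k * w i))
    (fun _ _ => 0) (appendSeq r (fun i => -y (r - 1 - i)) (fun _ => 0))

/-- The second of the four sequences in Yang's product. -/
def yangSeq₂ (l r s : ℕ) (F G H x y z w : ℕ → ℤ) : ℕ → ℤ :=
  tileSeq (r + s) l
    (fun k => appendSeq r (fun i => F (l - 1 - k) * y i)
      (fun i => G (l - 1 - k) * w i - H (l - 1 - k) * z i))
    (fun _ _ => 0) (appendSeq r (fun i => x (r - 1 - i)) (fun _ => 0))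

/-- The third of the four sequences in Yang's product. -/
def yangSeq₃ (l r s : ℕ) (F G H x y z w : ℕ → ℤ) : ℕ → ℤ :=
  tileSeq (r + s) l (fun _ _ => 0)
    (fun k => appendSeq r (fun i => G (l - 1 - k) * x i - H k * y i) (fun i => -(F k * z i)))
    (appendSeq r (fun _ => 0) (fun i => -w (s - 1 - i)))

/-- The fourth of the four sequences in Yang's product. -/
def yangSeq₄ (l r s : ℕ) (F G H x y z w : ℕ → ℤ) : ℕ → ℤ :=
  tileSeq (r + s) l (fun _ _ => 0)
    (fun k => appendSeq r (fun i => G k * y i + H (l - 1 - k) * x i) (fun i => -(F k * w i)))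
    (appendSeq r (fun _ => 0) (fun i => z (s - 1 - i)))

section Products

variable {u v : R} (huv : u * v = 1) (l r s : ℕ) (F G H x y z w : ℕ → ℤ)
include huv

lemma genSum_yangSeq₁ :
    genSum u ((2 * l + 1) * (r + s)) (yangSeq₁ l r s F G H x y z w) =
      (u ^ (2 * (r + s))) ^ l * v ^ (2 * (r + s)) * genSum (v ^ (2 * (r + s))) l F *
        genSum u r x +
      u ^ r * (genSum (u ^ (2 * (r + s))) l G * genSum u s z +
        genSum (u ^ (2 * (r + s))) l H * genSum u s w) -
      (u ^ (2 * (r + s))) ^ l * u ^ r * v * genSum v r y := by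
  have hpow : u ^ (2 * (r + s)) * v ^ (2 * (r + s)) = 1 := by rw [← mul_pow, huv, one_pow]
  rw [yangSeq₁, genSum_tileSeq]
  generalize u ^ (2 * (r + s)) = Y, v ^ (2 * (r + s)) = V at hpow ⊢
  simp only [genSum_appendSeq, genSum_const_mul, genSum_zero, genSum_add, genSum_neg, mul_add,
    sum_add_distrib,
    sum_pow_mul, sum_pow_mul_mul, mul_zero, sum_const_zero, genSum_reflect hpow l F,
    genSum_reflect huv r y]
  ring

lemma genSum_yangSeq₂ :
    genSum u ((2 * l + 1) * (r + s)) (yangSeq₂ l r s F G H x y z w) =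
      (u ^ (2 * (r + s))) ^ l * v ^ (2 * (r + s)) * genSum (v ^ (2 * (r + s))) l F *
        genSum u r y +
      u ^ r * ((u ^ (2 * (r + s))) ^ l * v ^ (2 * (r + s)) * genSum (v ^ (2 * (r + s))) l G *
          genSum u s w -
        (u ^ (2 * (r + s))) ^ l * v ^ (2 * (r + s)) * genSum (v ^ (2 * (r + s))) l H *
          genSum u s z) +
      (u ^ (2 * (r + s))) ^ l * u ^ r * v * genSum v r x := by
  have hpow : u ^ (2 * (r + s)) * v ^ (2 * (r + s)) = 1 := by rw [← mul_pow, huv, one_pow]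
  rw [yangSeq₂, genSum_tileSeq]
  generalize u ^ (2 * (r + s)) = Y, v ^ (2 * (r + s)) = V at hpow ⊢
  simp only [genSum_appendSeq, genSum_const_mul, genSum_zero, genSum_sub, mul_add, mul_sub,
    sum_add_distrib, sum_sub_distrib,
    sum_pow_mul, sum_pow_mul_mul, mul_zero, sum_const_zero, genSum_reflect hpow l F,
    genSum_reflect hpow l G,
    genSum_reflect hpow l H, genSum_reflect huv r x]
  ring

lemma genSum_yangSeq₃ :
    genSum u ((2 * l + 1) * (r + s)) (yangSeq₃ l r s F G H x y z w) =
      u ^ (r + s) * ((u ^ (2 * (r + s))) ^ l * v ^ (2 * (r + s)) *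
          genSum (v ^ (2 * (r + s))) l G * genSum u r x -
        genSum (u ^ (2 * (r + s))) l H * genSum u r y -
        u ^ r * (genSum (u ^ (2 * (r + s))) l F * genSum u s z)) -
      (u ^ (2 * (r + s))) ^ l * u ^ (r + s) * v * genSum v s w := by
  have hpow : u ^ (2 * (r + s)) * v ^ (2 * (r + s)) = 1 := by rw [← mul_pow, huv, one_pow]
  rw [yangSeq₃, genSum_tileSeq]
  generalize u ^ (2 * (r + s)) = Y, v ^ (2 * (r + s)) = V at hpow ⊢
  simp only [genSum_appendSeq, genSum_const_mul, genSum_zero, genSum_neg, genSum_sub, mul_add,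
    mul_neg, mul_sub, sum_add_distrib, sum_neg_distrib, sum_sub_distrib,
    sum_pow_mul, sum_pow_mul_mul, mul_zero, sum_const_zero, genSum_reflect hpow l G,
    genSum_reflect huv s w]
  ring

lemma genSum_yangSeq₄ :
    genSum u ((2 * l + 1) * (r + s)) (yangSeq₄ l r s F G H x y z w) =
      u ^ (r + s) * (genSum (u ^ (2 * (r + s))) l G * genSum u r y +
        (u ^ (2 * (r + s))) ^ l * v ^ (2 * (r + s)) *
          genSum (v ^ (2 * (r + s))) l H * genSum u r x -
        u ^ r * (genSum (u ^ (2 * (r + s))) l F * genSum u s w)) +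
      (u ^ (2 * (r + s))) ^ l * u ^ (r + s) * v * genSum v s z := by
  have hpow : u ^ (2 * (r + s)) * v ^ (2 * (r + s)) = 1 := by rw [← mul_pow, huv, one_pow]
  rw [yangSeq₄, genSum_tileSeq]
  generalize u ^ (2 * (r + s)) = Y, v ^ (2 * (r + s)) = V at hpow ⊢
  simp only [genSum_appendSeq, genSum_const_mul, genSum_zero, genSum_add, genSum_neg, mul_add,
    mul_neg, sum_add_distrib, sum_neg_distrib,
    sum_pow_mul, sum_pow_mul_mul, mul_zero, sum_const_zero, genSum_reflect hpow l H,
    genSum_reflect huv s z]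
  ring

/-- The total squared modulus of Yang's four products factors. -/
lemma yangSeq_norm_mul :
    genSum u ((2 * l + 1) * (r + s)) (yangSeq₁ l r s F G H x y z w) *
      genSum v ((2 * l + 1) * (r + s)) (yangSeq₁ l r s F G H x y z w) +
    genSum u ((2 * l + 1) * (r + s)) (yangSeq₂ l r s F G H x y z w) *
      genSum v ((2 * l + 1) * (r + s)) (yangSeq₂ l r s F G H x y z w) +
    genSum u ((2 * l + 1) * (r + s)) (yangSeq₃ l r s F G H x y z w) *
      genSum v ((2 * l + 1) * (r + s)) (yangSeq₃ l r s F G H x y z w) +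
    genSum u ((2 * l + 1) * (r + s)) (yangSeq₄ l r s F G H x y z w) *
      genSum v ((2 * l + 1) * (r + s)) (yangSeq₄ l r s F G H x y z w) =
    (genSum u r x * genSum v r x + genSum u r y * genSum v r y +
      genSum u s z * genSum v s z + genSum u s w * genSum v s w) *
    (1 + (genSum (u ^ (2 * (r + s))) l F * genSum (v ^ (2 * (r + s))) l F +
      genSum (u ^ (2 * (r + s))) l G * genSum (v ^ (2 * (r + s))) l G +
      genSum (u ^ (2 * (r + s))) l H * genSum (v ^ (2 * (r + s))) l H)) := by
  have hvu : v * u = 1 := by rw [mul_comm, huv]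
  have hpow (n : ℕ) : u ^ n * v ^ n = 1 := by rw [← mul_pow, huv, one_pow]
  have hsq (u v : R) : (u ^ (2 * (r + s))) ^ l * v ^ (2 * (r + s)) =
      (u ^ ((r + s) * l) * v ^ (r + s)) ^ 2 := by
    rw [mul_pow, ← pow_mul, ← pow_mul, ← pow_mul]
    ring_nf
  have hlast {u v : R} (huv : u * v = 1) : (u ^ (2 * (r + s))) ^ l * u ^ r * v =
      u ^ ((r + s) * l) * v ^ (r + s) * (u ^ ((r + s) * l) * u ^ (r + s) * u ^ r * v) := by
    have h : u ^ (r + s) * v ^ (r + s) = 1 := by rw [← mul_pow, huv, one_pow]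
    rw [show (u ^ (2 * (r + s))) ^ l = u ^ ((r + s) * l) * u ^ ((r + s) * l) by
      rw [← pow_mul, ← pow_add]; ring_nf]
    linear_combination -u ^ ((r + s) * l) * u ^ ((r + s) * l) * u ^ r * v * h
  have hlast' {u v : R} (huv : u * v = 1) : (u ^ (2 * (r + s))) ^ l * u ^ (r + s) * v =
      u ^ ((r + s) * l) * v ^ (r + s) * (u ^ ((r + s) * l) * u ^ (r + s) * u ^ r * v) *
        u ^ (r + s) * v ^ r := by
    have h : u ^ r * v ^ r = 1 := by rw [← mul_pow, huv, one_pow]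
    rw [← hlast huv]
    linear_combination -(u ^ (2 * (r + s))) ^ l * u ^ (r + s) * v * h
  rw [genSum_yangSeq₁ huv, genSum_yangSeq₁ hvu, genSum_yangSeq₂ huv, genSum_yangSeq₂ hvu,
    genSum_yangSeq₃ huv, genSum_yangSeq₃ hvu, genSum_yangSeq₄ huv, genSum_yangSeq₄ hvu,
    hlast huv, hlast hvu, hlast' huv, hlast' hvu, hsq, hsq]
  refine yang_shifted_identity _ _ _ _ _ _ _ _ _ _ _ _ _ _ ?_ ?_ (hpow r) (hpow (r + s))
  · linear_combination (u ^ (r + s) * v ^ (r + s) * u ^ r * v ^ r * u * v) * hpow ((r + s) * l) +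
      (u ^ r * v ^ r * u * v) * hpow (r + s) + u * v * hpow r + huv
  · linear_combination (u ^ (r + s) * v ^ (r + s)) * hpow ((r + s) * l) + hpow (r + s)

end Products

end Generating

lemma four_autocorr_eq_zero_of_genSum {m : ℕ} {c : ℤ} (X₁ X₂ X₃ X₄ : ℕ → ℤ)
    (h : genSum (LaurentPolynomial.T 1 : LaurentPolynomial ℤ) m X₁ *
          genSum (LaurentPolynomial.T (-1)) m X₁ +
        genSum (LaurentPolynomial.T 1) m X₂ * genSum (LaurentPolynomial.T (-1)) m X₂ +
        genSum (LaurentPolynomial.T 1) m X₃ * genSum (LaurentPolynomial.T (-1)) m X₃ +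
        genSum (LaurentPolynomial.T 1) m X₄ * genSum (LaurentPolynomial.T (-1)) m X₄ =
        (c : LaurentPolynomial ℤ)) {j : ℕ} (hj : 1 ≤ j) :
    autocorr m X₁ j + autocorr m X₂ j + autocorr m X₃ j + autocorr m X₄ j = 0 := by
  have hT : (LaurentPolynomial.T 1 : LaurentPolynomial ℤ) * LaurentPolynomial.T (-1) = 1 := by
    rw [← LaurentPolynomial.T_add]
    simp
  set N : ℕ → ℤ := fun j =>
    autocorr m X₁ j + autocorr m X₂ j + autocorr m X₃ j + autocorr m X₄ j with hN
  have hsum : ∑ i ∈ range m, (N (i + 1) : LaurentPolynomial ℤ) *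
      (LaurentPolynomial.T 1 ^ (i + 1) + LaurentPolynomial.T (-1) ^ (i + 1)) =
      ((c - N 0 : ℤ) : LaurentPolynomial ℤ) := by
    simp only [genSum_mul_genSum hT _ le_rfl] at h
    simp only [hN, Int.cast_add, Int.cast_sub, add_mul, sum_add_distrib] at h ⊢
    linear_combination h
  change N j = 0
  rcases lt_or_ge m j with hlt | hle
  · simp only [hN, autocorr_eq_zero_of_le _ hlt.le, add_zero]
  have hcoeff := congrArg (fun p => p.coeff (j : ℤ)) hsum
  simp only [← zsmul_one (c - N 0), ← zsmul_eq_mul, AddMonoidAlgebra.coeff_sum,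
    Finsupp.finsetSum_apply, AddMonoidAlgebra.coeff_smul_apply, AddMonoidAlgebra.coeff_add,
    Finsupp.add_apply, LaurentPolynomial.T_pow, LaurentPolynomial.T_apply,
    ← LaurentPolynomial.T_zero] at hcoeff
  rw [sum_eq_single (j - 1)] at hcoeff
  · rw [if_pos (by omega), if_neg (by omega), if_neg (by omega), Nat.sub_add_cancel hj] at hcoeff
    simpa using hcoeff
  · intro i _ hi
    rw [if_neg (by omega), if_neg (by omega)]
    simp
  · intro hj'
    exact absurd (mem_range.2 (by omega)) hj'

lemma two_mul_half_add_half_sub {p q : ℤ} (hp : p = 1 ∨ p = -1) (hq : q = 1 ∨ q = -1) :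
    2 * ((p + q) / 2) = p + q ∧ 2 * ((p - q) / 2) = p - q := by
  rcases hp with rfl | rfl <;> rcases hq with rfl | rfl <;> decide

lemma autocorr_half {m : ℕ} {A B : ℕ → ℤ} (hA : IsBinarySeq m A) (hB : IsBinarySeq m B)
    (j : ℕ) :
    2 * (autocorr m (fun i => (A i + B i) / 2) j + autocorr m (fun i => (A i - B i) / 2) j) =
      autocorr m A j + autocorr m B j := by
  simp only [autocorr, ← sum_add_distrib, mul_sum]
  refine sum_congr rfl fun k hk => ?_
  have hk := mem_range.1 hk
  obtain ⟨h₁, h₂⟩ := two_mul_half_add_half_sub (hA k (by omega)) (hB k (by omega))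
  obtain ⟨h₃, h₄⟩ := two_mul_half_add_half_sub (hA (k + j) (by omega)) (hB (k + j) (by omega))
  have : 2 * (2 * ((A k + B k) / 2 * ((A (k + j) + B (k + j)) / 2) +
      (A k - B k) / 2 * ((A (k + j) - B (k + j)) / 2))) =
      2 * (A k * A (k + j) + B k * B (k + j)) := by
    linear_combination 2 * ((A (k + j) + B (k + j)) / 2) * h₁ + (A k + B k) * h₃ +
      2 * ((A (k + j) - B (k + j)) / 2) * h₂ + (A k - B k) * h₄
  linarith

/-- `X` and `Y` are `{-1, 0, 1}`-valued with complementary supports on the first `m` positions. -/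
def IsSupplementary (m : ℕ) (X Y : ℕ → ℤ) : Prop :=
  ∀ i < m, X i ^ 2 + Y i ^ 2 = 1 ∧ X i * Y i = 0

lemma isSupplementary_half {m : ℕ} {A B : ℕ → ℤ} (hA : IsBinarySeq m A)
    (hB : IsBinarySeq m B) :
    IsSupplementary m (fun i => (A i + B i) / 2) (fun i => (A i - B i) / 2) := by
  intro i hi
  rcases hA i hi with h | h <;> rcases hB i hi with h' | h' <;> simp [h, h']

lemma eq_one_or_neg_one_or_of_sq_add_sq {a b : ℤ} (h : a ^ 2 + b ^ 2 = 1) (hab : a * b = 0) :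
    ((a = 1 ∨ a = -1) ∧ b = 0) ∨ (a = 0 ∧ (b = 1 ∨ b = -1)) := by
  rcases mul_eq_zero.1 hab with rfl | rfl
  · exact Or.inr ⟨rfl, mul_self_eq_one_iff.1 (by simpa [sq] using h)⟩
  · exact Or.inl ⟨mul_self_eq_one_iff.1 (by simpa [sq] using h), rfl⟩

lemma even_sum_add_sum_reflect {l m : ℕ} {F G H : ℕ → ℤ} (hF : IsBinarySeq l F)
    (hGH : IsSupplementary l G H)
    (h0 : ∀ j, 1 ≤ j → autocorr l F j + autocorr l G j + autocorr l H j = 0) (hm : m < l) :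
    Even (∑ k ∈ range m, (H k + H (l - 1 - k))) := by
  have hrefl : ∑ k ∈ range m, (H k + H (l - 1 - k)) =
      ∑ k ∈ range m, (H k + H (k + (l - m))) := by
    rw [sum_add_distrib, sum_add_distrib, ← sum_range_reflect (fun k => H (k + (l - m)))]
    congr 1
    refine sum_congr rfl fun k hk => ?_
    have hk := mem_range.1 hk
    congr 1
    omega
  have hodd (i : ℕ) (hi : i < l) : (G i : ZMod 2) = 1 + H i ∧ (F i : ZMod 2) = 1 := by
    obtain ⟨h₁, h₂⟩ := hGH i hi
    constructor
    · rcases eq_one_or_neg_one_or_of_sq_add_sq h₁ h₂ with ⟨h | h, h'⟩ | ⟨h, h' | h'⟩ <;>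
        simp only [h, h'] <;> decide
    · rcases hF i hi with h | h <;> simp only [h] <;> decide
  have h0 := h0 (l - m) (by omega)
  simp only [autocorr, ← sum_add_distrib, show l - (l - m) = m by omega] at h0
  rw [hrefl, ← ZMod.intCast_eq_zero_iff_even, ← Int.cast_zero (R := ZMod 2), ← h0, Int.cast_sum,
    Int.cast_sum]
  refine sum_congr rfl fun k hk => ?_
  have hk := mem_range.1 hk
  obtain ⟨h₁, h₂⟩ := hodd k (by omega)
  obtain ⟨h₃, h₄⟩ := hodd (k + (l - m)) (by omega)
  push_cast
  rw [h₁, h₂, h₃, h₄]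
  generalize (H k : ZMod 2) = x
  generalize (H (k + (l - m)) : ZMod 2) = y
  decide +revert

lemma sq_reflect_of_autocorr {l : ℕ} {F G H : ℕ → ℤ} (hF : IsBinarySeq l F)
    (hGH : IsSupplementary l G H)
    (h0 : ∀ j, 1 ≤ j → autocorr l F j + autocorr l G j + autocorr l H j = 0) {k : ℕ}
    (hk : k < l) : H (l - 1 - k) ^ 2 = H k ^ 2 ∧ G (l - 1 - k) ^ 2 = G k ^ 2 := by
  have heven (k : ℕ) (hk : k + 1 < l) : Even (H k + H (l - 1 - k)) := by
    have h := even_sum_add_sum_reflect hF hGH h0 hk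
    rw [sum_range_succ, Int.even_add] at h
    exact h.1 (even_sum_add_sum_reflect hF hGH h0 (by omega))
  have heven : Even (H k + H (l - 1 - k)) := by
    by_cases hkl : k + 1 < l
    · exact heven k hkl
    · obtain rfl : k = l - 1 := by omega
      rcases Nat.eq_zero_or_pos (l - 1) with h | h
      · simp [h]
      · have := heven 0 (by omega)
        rwa [Nat.sub_zero, add_comm, ← Nat.sub_self (l - 1)] at this
  obtain ⟨h₁, h₂⟩ := hGH k hk
  obtain ⟨h₃, h₄⟩ := hGH (l - 1 - k) (by omega)
  have hH : H (l - 1 - k) ^ 2 = H k ^ 2 := by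
    rcases eq_one_or_neg_one_or_of_sq_add_sq h₁ h₂ with ⟨-, h⟩ | ⟨-, h | h⟩ <;>
    rcases eq_one_or_neg_one_or_of_sq_add_sq h₃ h₄ with ⟨-, h'⟩ | ⟨-, h' | h'⟩ <;>
    rw [h, h'] at heven ⊢ <;> first | rfl | exact absurd heven (by decide)
  exact ⟨hH, by linarith⟩

lemma IsNormalSeq.exists_supplementary {l : ℕ} {A B C D : ℕ → ℤ} (h : IsNormalSeq l A B C D) :
    ∃ F G H : ℕ → ℤ, IsBinarySeq l F ∧ IsSupplementary l G H ∧
      ∀ j, 1 ≤ j → autocorr l F j + autocorr l G j + autocorr l H j = 0 := by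
  obtain ⟨⟨hA, hB, hC, hD, h0⟩, hAB⟩ := h
  refine ⟨A, fun i => (C i + D i) / 2, fun i => (C i - D i) / 2, fun i hi => hA i (by omega),
    isSupplementary_half hC hD, fun j hj => ?_⟩
  rcases lt_or_ge l j with hlt | hle
  · simp only [autocorr_eq_zero_of_le _ hlt.le, add_zero]
  have hlast : A l + B l = 0 := by
    have hl := h0 l (by omega)
    simp only [autocorr, Nat.sub_self, sum_range_zero, Nat.add_sub_cancel_left, sum_range_one,
      zero_add, add_zero, hAB 0 (by omega), ← mul_add] at hl
    rcases mul_eq_zero.1 hl with h | h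
    · rcases hA 0 (by omega) with h' | h' <;> omega
    · exact h
  have hrest : autocorr l B j = autocorr l A j := by
    refine sum_congr rfl fun k hk => ?_
    have hk := mem_range.1 hk
    rw [hAB k (by omega), hAB (k + j) (by omega)]
  have h0 := h0 j hj
  rw [autocorr_succ, autocorr_succ, if_pos hle, if_pos hle, hrest, hAB (l - j) (by omega)] at h0
  have hCD := autocorr_half hC hD j
  have : A (l - j) * A l + A (l - j) * B l = 0 := by rw [← mul_add, hlast, mul_zero]
  linarith

lemma isTSeq_of_sum_sq {t : ℕ} {T₁ T₂ T₃ T₄ : ℕ → ℤ}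
    (hsq : ∀ i < t, T₁ i ^ 2 + T₂ i ^ 2 + T₃ i ^ 2 + T₄ i ^ 2 = 1)
    (h0 : ∀ j, 1 ≤ j →
      autocorr t T₁ j + autocorr t T₂ j + autocorr t T₃ j + autocorr t T₄ j = 0) :
    IsTSeq t T₁ T₂ T₃ T₄ := by
  have hmem (a : ℤ) (h : a ^ 2 ≤ 1) : a = -1 ∨ a = 0 ∨ a = 1 := by
    have := abs_le_of_sq_le_sq' (a := a) (b := 1) (by simpa using h) (by norm_num)
    omega
  refine ⟨fun i hi => ?_, fun i hi => ?_, fun i hi => ?_, fun i hi => ?_, fun i hi => ?_, h0⟩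
  · exact hmem _ (by nlinarith [hsq i hi])
  · exact hmem _ (by nlinarith [hsq i hi])
  · exact hmem _ (by nlinarith [hsq i hi])
  · exact hmem _ (by nlinarith [hsq i hi])
  · have h := hsq i hi
    have h₁ := hmem (T₁ i) (by nlinarith)
    have h₂ := hmem (T₂ i) (by nlinarith)
    have h₃ := hmem (T₃ i) (by nlinarith)
    have h₄ := hmem (T₄ i) (by nlinarith)
    rcases h₁ with h₁ | h₁ | h₁ <;> rcases h₂ with h₂ | h₂ | h₂ <;>
    rcases h₃ with h₃ | h₃ | h₃ <;> rcases h₄ with h₄ | h₄ | h₄ <;>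
    simp [h₁, h₂, h₃, h₄] at h ⊢

lemma tileSeq_forall {t l : ℕ} {P : ℤ → ℤ → ℤ → ℤ → Prop} {E₁ E₂ E₃ E₄ O₁ O₂ O₃ O₄ : ℕ → ℕ → ℤ}
    {L₁ L₂ L₃ L₄ : ℕ → ℤ}
    (hE : ∀ k < l, ∀ p < t, P (E₁ k p) (E₂ k p) (E₃ k p) (E₄ k p))
    (hO : ∀ k < l, ∀ p < t, P (O₁ k p) (O₂ k p) (O₃ k p) (O₄ k p))
    (hL : ∀ p < t, P (L₁ p) (L₂ p) (L₃ p) (L₄ p)) {n : ℕ} (hn : n < (2 * l + 1) * t) :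
    P (tileSeq t l E₁ O₁ L₁ n) (tileSeq t l E₂ O₂ L₂ n) (tileSeq t l E₃ O₃ L₃ n)
      (tileSeq t l E₄ O₄ L₄ n) := by
  have ht : 0 < t := Nat.pos_of_ne_zero fun h => by simp [h] at hn
  have hp := Nat.mod_lt n ht
  have hb : n / t < 2 * l + 1 := Nat.div_lt_of_lt_mul (by rwa [mul_comm])
  simp only [tileSeq]
  split_ifs with h₁ h₂
  · exact hL _ hp
  · exact hE _ (by omega) _ hp
  · exact hO _ (by omega) _ hp

lemma yangSeq_sum_sq {l r s : ℕ} {F G H x y z w : ℕ → ℤ} (hF : IsBinarySeq l F)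
    (hGH : IsSupplementary l G H) (hxy : IsSupplementary r x y) (hzw : IsSupplementary s z w)
    (hrefl : ∀ k < l, H (l - 1 - k) ^ 2 = H k ^ 2 ∧ G (l - 1 - k) ^ 2 = G k ^ 2)
    {n : ℕ} (hn : n < (2 * l + 1) * (r + s)) :
    yangSeq₁ l r s F G H x y z w n ^ 2 + yangSeq₂ l r s F G H x y z w n ^ 2 +
      yangSeq₃ l r s F G H x y z w n ^ 2 + yangSeq₄ l r s F G H x y z w n ^ 2 = 1 := by
  have hFsq (k : ℕ) (hk : k < l) : F k ^ 2 = 1 := by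
    rcases hF k hk with h | h <;> simp [h]
  refine tileSeq_forall (P := fun a b c d => a ^ 2 + b ^ 2 + c ^ 2 + d ^ 2 = 1) ?_ ?_ ?_ hn
  · intro k hk p hp
    have hF := hFsq (l - 1 - k) (by omega)
    obtain ⟨hGH, -⟩ := hGH k hk
    obtain ⟨hH, hG⟩ := hrefl k hk
    simp only [appendSeq]
    split_ifs with h
    · obtain ⟨hxy, -⟩ := hxy p h
      linear_combination (x p ^ 2 + y p ^ 2) * hF + hxy
    · obtain ⟨hzw, hzw'⟩ := hzw (p - r) (by omega)
      linear_combination (2 * G k * H k - 2 * G (l - 1 - k) * H (l - 1 - k)) * hzw' +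
        w (p - r) ^ 2 * hG + z (p - r) ^ 2 * hH +
        (z (p - r) ^ 2 + w (p - r) ^ 2) * hGH + hzw
  · intro k hk p hp
    have hF := hFsq k hk
    obtain ⟨hGH, -⟩ := hGH k hk
    obtain ⟨hH, hG⟩ := hrefl k hk
    simp only [appendSeq]
    split_ifs with h
    · obtain ⟨hxy, hxy'⟩ := hxy p h
      linear_combination (2 * G k * H (l - 1 - k) - 2 * G (l - 1 - k) * H k) * hxy' +
        x p ^ 2 * hG + x p ^ 2 * hH + (x p ^ 2 + y p ^ 2) * hGH + hxy
    · obtain ⟨hzw, -⟩ := hzw (p - r) (by omega)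
      linear_combination (z (p - r) ^ 2 + w (p - r) ^ 2) * hF + hzw
  · intro p hp
    simp only [appendSeq]
    split_ifs with h
    · obtain ⟨hxy, -⟩ := hxy (r - 1 - p) (by omega)
      linear_combination hxy
    · obtain ⟨hzw, -⟩ := hzw (s - 1 - (p - r)) (by omega)
      linear_combination hzw

section Norms

variable {R : Type*} [CommRing R] {u v : R} (huv : u * v = 1)
include huv

lemma genSum_norm_four {r s : ℕ} {x y z w : ℕ → ℤ}
    (h0 : ∀ j, 1 ≤ j →
      autocorr r x j + autocorr r y j + autocorr s z j + autocorr s w j = 0) :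
    genSum u r x * genSum v r x + genSum u r y * genSum v r y +
      genSum u s z * genSum v s z + genSum u s w * genSum v s w =
      ((autocorr r x 0 + autocorr r y 0 + autocorr s z 0 + autocorr s w 0 : ℤ) : R) := by
  have hsum : ∑ j ∈ range (r + s), ((autocorr r x (j + 1) + autocorr r y (j + 1) +
      autocorr s z (j + 1) + autocorr s w (j + 1) : ℤ) : R) *
        (u ^ (j + 1) + v ^ (j + 1)) = 0 :=
    sum_eq_zero fun j _ => by rw [h0 (j + 1) (by omega), Int.cast_zero, zero_mul]
  simp only [genSum_mul_genSum huv _ (Nat.le_add_right r s),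
    genSum_mul_genSum huv _ (Nat.le_add_left s r)]
  simp only [Int.cast_add, add_mul, sum_add_distrib] at hsum ⊢
  linear_combination hsum

lemma genSum_norm_three {l : ℕ} {F G H : ℕ → ℤ}
    (h0 : ∀ j, 1 ≤ j → autocorr l F j + autocorr l G j + autocorr l H j = 0) :
    genSum u l F * genSum v l F + genSum u l G * genSum v l G + genSum u l H * genSum v l H =
      ((autocorr l F 0 + autocorr l G 0 + autocorr l H 0 : ℤ) : R) := by
  have hzero (m j : ℕ) : autocorr m (fun _ => 0) j = 0 := by simp [autocorr]
  have h := genSum_norm_four huv (r := l) (s := l) (x := F) (y := G) (z := H) (w := fun _ => 0)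
    fun j hj => by rw [hzero, add_zero, h0 j hj]
  simpa only [genSum_zero, hzero, mul_zero, add_zero] using h

end Norms

/-- Yang multiplication, first form: normal sequences `NS(l)`
and base sequences `BS(r,s)` yield T-sequences of length `(2l+1)(r+s)`. -/
theorem yang_multiplication_normal (l r s : ℕ)
    (hNS : ∃ A B C D : ℕ → ℤ, IsNormalSeq l A B C D)
    (hBS : ∃ A B C D : ℕ → ℤ, IsBaseSeq r s A B C D) :
    ∃ T₁ T₂ T₃ T₄ : ℕ → ℤ, IsTSeq ((2 * l + 1) * (r + s)) T₁ T₂ T₃ T₄ := by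
  obtain ⟨A', B', C', D', hN⟩ := hNS
  obtain ⟨A, B, C, D, hA, hB, hC, hD, h0⟩ := hBS
  obtain ⟨F, G, H, hF, hGH, hFGH⟩ := hN.exists_supplementary
  set x : ℕ → ℤ := fun i => (A i + B i) / 2
  set y : ℕ → ℤ := fun i => (A i - B i) / 2
  set z : ℕ → ℤ := fun i => (C i + D i) / 2
  set w : ℕ → ℤ := fun i => (C i - D i) / 2
  have hxyzw (j : ℕ) (hj : 1 ≤ j) :
      autocorr r x j + autocorr r y j + autocorr s z j + autocorr s w j = 0 := by
    have h₁ := autocorr_half hA hB j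
    have h₂ := autocorr_half hC hD j
    have h₃ := h0 j hj
    linarith
  refine ⟨yangSeq₁ l r s F G H x y z w, yangSeq₂ l r s F G H x y z w,
    yangSeq₃ l r s F G H x y z w, yangSeq₄ l r s F G H x y z w,
    isTSeq_of_sum_sq (fun i hi => yangSeq_sum_sq hF hGH (isSupplementary_half hA hB)
      (isSupplementary_half hC hD) (fun k hk => sq_reflect_of_autocorr hF hGH hFGH hk) hi)
      fun j hj => ?_⟩
  refine four_autocorr_eq_zero_of_genSum (c :=
    (autocorr r x 0 + autocorr r y 0 + autocorr s z 0 + autocorr s w 0) *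
      (1 + (autocorr l F 0 + autocorr l G 0 + autocorr l H 0))) _ _ _ _ ?_ hj
  have hT : (LaurentPolynomial.T 1 : LaurentPolynomial ℤ) * LaurentPolynomial.T (-1) = 1 := by
    rw [← LaurentPolynomial.T_add]
    simp
  have hpow (n : ℕ) :
      (LaurentPolynomial.T 1 : LaurentPolynomial ℤ) ^ n * LaurentPolynomial.T (-1) ^ n = 1 := by
    rw [← mul_pow, hT, one_pow]
  rw [yangSeq_norm_mul hT, genSum_norm_four hT hxyzw, genSum_norm_three (hpow _) hFGH]
  push_cast
  ring
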